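/- Let a > 1 and z ≥ 0 be integers with a − z > 0, and let β be the unique real root greater than 1 of the polynomial P(X) = X^3 − aX^2 − (a−z)X − 1. Then for every integer k ≥ 1 with a ≥ kz + 2k − 1, one has L_⊕(β) ≥ 2k + 1; more precisely, there exist x, y ∈ ℤ_β with x + y ∈ fin(β) but β^{2k}·(x + y) ∉ ℤ_β. -/

import Mathlib

open Polynomial

/-- The β-transformation `T_β(x) = βx - ⌊βx⌋`. -/
noncomputable def betaT (β : ℝ) : ℝ → ℝ := fun x => β * x - ⌊β * x⌋

/-- `fin(β)`: reals `x` such that `|x|/β^N ∈ [0,1)` and the greedy expansion of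
`|x|/β^N` is finite, for some `N, n ∈ ℕ`. -/
def finBeta (β : ℝ) : Set ℝ :=
  {x | ∃ N n : ℕ, |x| / β ^ N ∈ Set.Ico (0 : ℝ) 1 ∧ (betaT β)^[n] (|x| / β ^ N) = 0}

/-- `ℤ_β`: the set of β-integers. -/
def betaInt (β : ℝ) : Set ℝ :=
  {x | ∃ N : ℕ, |x| / β ^ N ∈ Set.Ico (0 : ℝ) 1 ∧ (betaT β)^[N] (|x| / β ^ N) = 0}

/-- `L_⊕(β)`: the least `L ∈ ℕ` such that `β^L·(x+y) ∈ ℤ_β` for all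
`x, y ∈ ℤ_β` with `x + y ∈ fin(β)`. -/
noncomputable def Lplus (β : ℝ) : ℕ :=
  sInf {L : ℕ | ∀ x ∈ betaInt β, ∀ y ∈ betaInt β,
    x + y ∈ finBeta β → β ^ L * (x + y) ∈ betaInt β}

/-- `L_⊗(β)`: the least `L ∈ ℕ` such that `β^L·(x·y) ∈ ℤ_β` for all
`x, y ∈ ℤ_β` with `x·y ∈ fin(β)`. -/
noncomputable def Lmul (β : ℝ) : ℕ :=
  sInf {L : ℕ | ∀ x ∈ betaInt β, ∀ y ∈ betaInt β,
    x * y ∈ finBeta β → β ^ L * (x * y) ∈ betaInt β}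

section BetaExpansion

variable {β : ℝ}

lemma betaT_zero : betaT β 0 = 0 := by simp [betaT]

lemma betaT_iterate_zero (n : ℕ) : (betaT β)^[n] 0 = 0 :=
  Function.iterate_fixed betaT_zero n

lemma betaT_mem_Ico (x : ℝ) : betaT β x ∈ Set.Ico (0 : ℝ) 1 :=
  ⟨Int.fract_nonneg _, Int.fract_lt_one _⟩

lemma betaT_iterate_mem_Ico {x : ℝ} (hx : x ∈ Set.Ico (0 : ℝ) 1) (n : ℕ) :
    (betaT β)^[n] x ∈ Set.Ico (0 : ℝ) 1 := by
  cases n with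
  | zero => exact hx
  | succ n => rw [Function.iterate_succ_apply']; exact betaT_mem_Ico _

lemma betaT_div_pow_succ (hβ : 1 < β) {v : ℝ} {n : ℕ} (hv : 0 ≤ v) (hv' : v < β ^ n) (d : ℤ) :
    betaT β ((d * β ^ n + v) / β ^ (n + 1)) = v / β ^ n := by
  have h0 : 0 < β := by linarith
  have hn : 0 < β ^ n := by positivity
  have h : β * ((d * β ^ n + v) / β ^ (n + 1)) = d + v / β ^ n := by
    rw [pow_succ]
    field_simp
  have hf : ⌊v / β ^ n⌋ = 0 := by
    rw [Int.floor_eq_zero_iff]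
    exact ⟨by positivity, (div_lt_one hn).2 hv'⟩
  simp [betaT, h, hf]

lemma betaT_iterate_div_pow (hβ : 1 < β) {u : ℝ} (hu : u ∈ Set.Ico (0 : ℝ) 1) (n : ℕ) :
    (betaT β)^[n] (u / β ^ n) = u := by
  induction n with
  | zero => simp
  | succ n ih =>
    have h := betaT_div_pow_succ hβ hu.1 (hu.2.trans_le (one_le_pow₀ hβ.le (n := n))) 0
    rw [Function.iterate_succ_apply]
    simp only [Int.cast_zero, zero_mul, zero_add] at h
    rw [h, ih]

lemma betaT_iterate_add_of_mem (hβ : 1 < β) {x : ℝ} {N : ℕ}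
    (hx : x / β ^ N ∈ Set.Ico (0 : ℝ) 1) (M : ℕ) :
    (betaT β)^[N + M] (x / β ^ (N + M)) = (betaT β)^[N] (x / β ^ N) := by
  rw [Function.iterate_add_apply, pow_add, ← div_div, betaT_iterate_div_pow hβ hx]

lemma mul_mem_betaInt (hβ : 1 < β) {x : ℝ} (hx : x ∈ betaInt β) (m : ℕ) :
    β ^ m * x ∈ betaInt β := by
  obtain ⟨N, hN, h⟩ := hx
  have h0 : 0 < β := by linarith
  have e : |β ^ m * x| / β ^ (m + N) = |x| / β ^ N := by
    rw [abs_mul, abs_of_pos (pow_pos h0 m), pow_add]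
    field_simp
  refine ⟨m + N, by rwa [e], ?_⟩
  rw [e, Function.iterate_add_apply, h, betaT_iterate_zero]

/-- The greedy expansion of `v / β ^ (m + j)` reaches `t` after `m` steps. -/
def BetaReaches (β : ℝ) (j : ℕ) (t : ℝ) (m : ℕ) (v : ℝ) : Prop :=
  0 ≤ v ∧ v < β ^ (m + j) ∧ (betaT β)^[m] (v / β ^ (m + j)) = t

lemma BetaReaches.prepend (hβ : 1 < β) {j m n : ℕ} {t v w : ℝ} (h : BetaReaches β j t m v)
    (d : ℤ) (hd : 0 ≤ d) (hn : n = m + 1) (hw : w = d * β ^ (m + j) + v)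
    (hlt : w < β ^ (n + j)) : BetaReaches β j t n w := by
  obtain ⟨h1, h2, h3⟩ := h
  subst hn
  have h0 : 0 < β := by linarith
  have hd' : (0 : ℝ) ≤ d := by exact_mod_cast hd
  refine ⟨by rw [hw]; positivity, hlt, ?_⟩
  rw [Function.iterate_succ_apply, hw, show m + 1 + j = m + j + 1 by ring,
    betaT_div_pow_succ hβ h1 h2, h3]

lemma BetaReaches.prepend_of_lt (hβ : 1 < β) {j m n : ℕ} {t v w : ℝ}
    (h : BetaReaches β j t m v) (d : ℤ) (hd : 0 ≤ d) (hd' : (d : ℝ) + 1 ≤ β) (hn : n = m + 1)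
    (hw : w = d * β ^ (m + j) + v) : BetaReaches β j t n w := by
  have h0 : 0 < β := by linarith
  refine h.prepend hβ d hd hn hw ?_
  have h2 := h.2.1
  have h3 : ((d : ℝ) + 1) * β ^ (m + j) ≤ β * β ^ (m + j) := by gcongr
  rw [hw, hn, show m + 1 + j = m + j + 1 by ring, pow_succ']
  linarith

lemma BetaReaches.mem_betaInt {m : ℕ} {v : ℝ} (hβ : 1 < β) (h : BetaReaches β 0 0 m v) :
    v ∈ betaInt β := by
  obtain ⟨h1, h2, h3⟩ := h
  have h0 : 0 < β := by linarith
  refine ⟨m, ?_, ?_⟩ <;> rw [abs_of_nonneg h1]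
  · exact ⟨by positivity, (div_lt_one (by positivity)).2 h2⟩
  · exact h3

lemma sum_mul_sq_pow_reaches (hβ : 1 < β) {a : ℤ} (hab : (a : ℝ) * β + 1 < β ^ 2)
    (f : ℕ → ℤ) (n : ℕ) (hf : ∀ i < n, 0 ≤ f i ∧ f i ≤ a) :
    BetaReaches β 0 0 (2 * n) (∑ i ∈ Finset.range n, (f i : ℝ) * (β ^ 2) ^ i) ∧
      β * ∑ i ∈ Finset.range n, (f i : ℝ) * (β ^ 2) ^ i < β ^ (2 * n) := by
  have h0 : 0 < β := by linarith
  induction n with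
  | zero => simp [BetaReaches]
  | succ n ih =>
    obtain ⟨h, hlt⟩ := ih fun i hi => hf i (by omega)
    obtain ⟨hf0, hf1⟩ := hf n (by omega)
    have hf1' : (f n : ℝ) ≤ a := by exact_mod_cast hf1
    have hp : 0 < β ^ (2 * n) := by positivity
    set S := ∑ i ∈ Finset.range n, (f i : ℝ) * (β ^ 2) ^ i
    have hS : ∑ i ∈ Finset.range (n + 1), (f i : ℝ) * (β ^ 2) ^ i = f n * β ^ (2 * n) + S := by
      rw [Finset.sum_range_succ, ← pow_mul, add_comm]
    rw [hS]
    have hlt' : β * (f n * β ^ (2 * n) + S) < β ^ (2 * (n + 1)) := by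
      have h1 : (f n : ℝ) * β * β ^ (2 * n) ≤ a * β * β ^ (2 * n) := by gcongr
      have h2 := mul_lt_mul_of_pos_right hab hp
      have h3 : β ^ (2 * (n + 1)) = β ^ 2 * β ^ (2 * n) := by ring
      rw [h3]
      linarith
    have hlt1 : f n * β ^ (2 * n) + S < β ^ (2 * n + 1) := by
      have : β ^ (2 * (n + 1)) = β * β ^ (2 * n + 1) := by ring
      rw [this] at hlt'
      exact lt_of_mul_lt_mul_left hlt' h0.le
    have h1 : BetaReaches β 0 0 (2 * n + 1) (f n * β ^ (2 * n) + S) :=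
      h.prepend hβ (f n) hf0 rfl rfl hlt1
    exact ⟨h1.prepend_of_lt hβ 0 le_rfl (by simpa using hβ.le) rfl (by simp), hlt'⟩

lemma not_mem_betaInt_div (hβ : 1 < β) {m : ℕ} {v : ℝ} (h : BetaReaches β 1 (1 / β) m v) :
    v / β ∉ betaInt β := by
  obtain ⟨h1, h2, h3⟩ := h
  have h0 : 0 < β := by linarith
  rintro ⟨N, hN, hT⟩
  rw [abs_of_nonneg (by positivity)] at hN hT
  have hv : v / β / β ^ m ∈ Set.Ico (0 : ℝ) 1 := by
    refine ⟨by positivity, ?_⟩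
    rw [div_div, ← pow_succ', div_lt_one (by positivity)]
    exact h2
  rw [pow_succ', ← div_div] at h3
  have e1 := betaT_iterate_add_of_mem hβ hN m
  have e2 := betaT_iterate_add_of_mem hβ hv N
  rw [add_comm m N, e1, hT, h3] at e2
  have : 0 < 1 / β := by positivity
  linarith

lemma div_pow_mem_finBeta (hβ : 1 < β) {m L : ℕ} {v : ℝ} (h : BetaReaches β 1 (1 / β) m v)
    (hL : L ≤ m + 1) : v / β ^ L ∈ finBeta β := by
  obtain ⟨h1, h2, h3⟩ := h
  have h0 : 0 < β := by linarith
  have e : |v / β ^ L| / β ^ (m + 1 - L) = v / β ^ (m + 1) := by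
    rw [abs_of_nonneg (by positivity), div_div, ← pow_add, Nat.add_sub_cancel' hL]
  refine ⟨m + 1 - L, m + 1, ?_, ?_⟩ <;> rw [e]
  · exact ⟨by positivity, (div_lt_one (by positivity)).2 h2⟩
  · rw [Function.iterate_succ_apply', h3]
    simp [betaT, h0.ne']

end BetaExpansion

section Carry

variable {a z : ℤ} {β : ℝ}

/-- The sum of the two β-integers whose fractional part is long. -/
noncomputable def carrySum (a z : ℤ) (β : ℝ) (k : ℕ) : ℝ :=
  ∑ i ∈ Finset.range k, ((a + 1 + (z + 2) * (k - 1 - i) : ℤ) : ℝ) * (β ^ 2) ^ i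

/-- The fractional part of `carrySum`, increased by `2 / β`. -/
noncomputable def carryFrac (a z : ℤ) (β : ℝ) (k : ℕ) : ℝ :=
  (z * k + k + 1) / β + (a - z - 1) * k / β ^ 2 + k / β ^ 3

lemma carrySum_succ (k : ℕ) :
    carrySum a z β (k + 1) = β ^ 2 * carrySum a z β k + (a + 1 + (z + 2) * k) := by
  simp only [carrySum, Finset.sum_range_succ', Finset.mul_sum]
  congr 1
  · refine Finset.sum_congr rfl fun i _ => ?_
    push_cast
    ring
  · push_cast
    ring

lemma lt_of_root (hβ : 1 < β) (haz : 0 < a - z)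
    (hroot : β ^ 3 - (a : ℝ) * β ^ 2 - ((a : ℝ) - (z : ℝ)) * β - 1 = 0) : (a : ℝ) < β := by
  have haz' : (0 : ℝ) < a - z := by exact_mod_cast haz
  by_contra! h
  nlinarith [mul_nonneg (sub_nonneg.2 h) (sq_nonneg β)]

lemma mul_add_one_lt_sq_of_root (hβ : 1 < β) (haz : 0 < a - z)
    (hroot : β ^ 3 - (a : ℝ) * β ^ 2 - ((a : ℝ) - (z : ℝ)) * β - 1 = 0) :
    (a : ℝ) * β + 1 < β ^ 2 := by
  have haz' : (1 : ℝ) ≤ a - z := by exact_mod_cast haz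
  by_contra! h
  nlinarith [mul_nonneg (sub_nonneg.2 h) (by linarith : 0 ≤ β)]

lemma carrySum_sub_carryFrac_one (hβ : 1 < β)
    (hroot : β ^ 3 - (a : ℝ) * β ^ 2 - ((a : ℝ) - (z : ℝ)) * β - 1 = 0) :
    carrySum a z β 1 - carryFrac a z β 1 + 2 / β = β := by
  have h0 : β ≠ 0 := by positivity
  simp only [carrySum, carryFrac, Finset.sum_range_one]
  push_cast
  field_simp
  linear_combination (1 - β) * hroot

lemma carrySum_sub_carryFrac_succ (hβ : 1 < β)
    (hroot : β ^ 3 - (a : ℝ) * β ^ 2 - ((a : ℝ) - (z : ℝ)) * β - 1 = 0) (k : ℕ) :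
    carrySum a z β (k + 1) - carryFrac a z β (k + 1) + 2 / β =
      β ^ 2 * (carrySum a z β k - carryFrac a z β k + 2 / β) + (z + 2) * k * β := by
  have h0 : β ≠ 0 := by positivity
  rw [carrySum_succ]
  simp only [carryFrac]
  push_cast
  field_simp
  linear_combination (1 - β) * (k + 1) * hroot

lemma carryFrac_succ (hβ : 1 < β)
    (hroot : β ^ 3 - (a : ℝ) * β ^ 2 - ((a : ℝ) - (z : ℝ)) * β - 1 = 0) (k : ℕ) :
    β ^ (2 * k + 3) * carryFrac a z β (k + 1) =
      (z + 2) * (k + 1) * β ^ (2 * k + 2) + (a - z - 1 - (z + 2) * k) * β ^ (2 * k + 1) +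
        β ^ (2 * k + 1) * carryFrac a z β k := by
  have h0 : β ≠ 0 := by positivity
  simp only [carryFrac, pow_add]
  push_cast
  field_simp
  linear_combination (1 - β) * k * hroot

lemma carryFrac_reaches (hz : 0 ≤ z) (hβ : 1 < β) (hab : (a : ℝ) < β)
    (hroot : β ^ 3 - (a : ℝ) * β ^ 2 - ((a : ℝ) - (z : ℝ)) * β - 1 = 0) (k : ℕ)
    (hk : (z + 2) * k ≤ a - 1) :
    BetaReaches β 1 (1 / β) (2 * k) (β ^ (2 * k + 1) * carryFrac a z β k) := by
  have h0 : β ≠ 0 := by positivity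
  induction k with
  | zero => simp [BetaReaches, carryFrac, h0, hβ]
  | succ k ih =>
    push_cast at hk
    have h := ih (by nlinarith)
    have h1 : BetaReaches β 1 (1 / β) (2 * k + 1) ((a - z - 1 - (z + 2) * k : ℤ) *
        β ^ (2 * k + 1) + β ^ (2 * k + 1) * carryFrac a z β k) := by
      refine h.prepend_of_lt hβ (a - z - 1 - (z + 2) * k) (by nlinarith) ?_ rfl rfl
      have : a - z - 1 - (z + 2) * k + 1 ≤ a := by nlinarith
      have : ((a - z - 1 - (z + 2) * k : ℤ) : ℝ) + 1 ≤ a := by exact_mod_cast this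
      linarith
    refine h1.prepend_of_lt hβ ((z + 2) * (k + 1)) (by positivity) ?_ rfl ?_
    · have : (z + 2) * (k + 1) + 1 ≤ a := by linarith
      have : (((z + 2) * (k + 1) : ℤ) : ℝ) + 1 ≤ a := by exact_mod_cast this
      linarith
    · rw [show 2 * (k + 1) + 1 = 2 * k + 3 by ring, carryFrac_succ hβ hroot]
      push_cast
      ring

lemma carrySum_sub_carryFrac_reaches (ha : 1 < a) (hz : 0 ≤ z) (hβ : 1 < β) (hab : (a : ℝ) < β)
    (hroot : β ^ 3 - (a : ℝ) * β ^ 2 - ((a : ℝ) - (z : ℝ)) * β - 1 = 0) (k : ℕ)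
    (hk : (z + 2) * k ≤ a - 1) {j m : ℕ} {t v : ℝ} (h : BetaReaches β j t m v) :
    BetaReaches β j t (m + 2 * (k + 1)) (β ^ (m + j) *
      (carrySum a z β (k + 1) - carryFrac a z β (k + 1) + 2 / β) + v) := by
  have h0 : β ≠ 0 := by positivity
  induction k generalizing m v with
  | zero =>
    have ha' : (1 : ℝ) + 1 ≤ a := by exact_mod_cast ha
    have h1 : BetaReaches β j t (m + 1) v :=
      h.prepend_of_lt hβ 0 le_rfl (by simpa using hβ.le) rfl (by simp)
    rw [zero_add, carrySum_sub_carryFrac_one hβ hroot]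
    refine h1.prepend_of_lt hβ 1 zero_le_one (by push_cast; linarith) rfl ?_
    push_cast
    ring
  | succ k ih =>
    push_cast at hk
    have h1 : BetaReaches β j t (m + 1) v :=
      h.prepend_of_lt hβ 0 le_rfl (by simpa using hβ.le) rfl (by simp)
    have h2 : BetaReaches β j t (m + 2)
        ((((z + 2) * (k + 1) : ℤ) : ℝ) * β ^ (m + 1 + j) + v) := by
      refine h1.prepend_of_lt hβ ((z + 2) * (k + 1)) (by positivity) ?_ rfl rfl
      have : (z + 2) * (k + 1) + 1 ≤ a := by linarith
      have : (((z + 2) * (k + 1) : ℤ) : ℝ) + 1 ≤ a := by exact_mod_cast this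
      linarith
    have h3 := ih (by nlinarith) h2
    rw [carrySum_sub_carryFrac_succ hβ hroot (k + 1)]
    convert h3 using 1
    · ring
    · push_cast
      ring

lemma carrySum_reaches (ha : 1 < a) (hz : 0 ≤ z) (hβ : 1 < β) (hab : (a : ℝ) < β)
    (hroot : β ^ 3 - (a : ℝ) * β ^ 2 - ((a : ℝ) - (z : ℝ)) * β - 1 = 0) (k : ℕ)
    (hk : (z + 2) * (k + 1) - 1 ≤ a) :
    BetaReaches β 1 (1 / β) (4 * (k + 1)) (β ^ (2 * (k + 1) + 1) * carrySum a z β (k + 1)) := by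
  have h0 : β ≠ 0 := by positivity
  have hzk : 0 ≤ z * k := by positivity
  have h := carryFrac_reaches hz hβ hab hroot k (by nlinarith)
  have h1 : BetaReaches β 1 (1 / β) (2 * k + 1) ((a - z - 1 - (z + 2) * k : ℤ) *
      β ^ (2 * k + 1) + β ^ (2 * k + 1) * carryFrac a z β k) := by
    refine h.prepend_of_lt hβ (a - z - 1 - (z + 2) * k) (by nlinarith) ?_ rfl rfl
    have : a - z - 1 - (z + 2) * k + 1 ≤ a := by nlinarith
    have : ((a - z - 1 - (z + 2) * k : ℤ) : ℝ) + 1 ≤ a := by exact_mod_cast this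
    linarith
  have h2 : BetaReaches β 1 (1 / β) (2 * k + 2)
      (((z + 2) * (k + 1) - 2 : ℤ) * β ^ (2 * k + 2) + ((a - z - 1 - (z + 2) * k : ℤ) *
      β ^ (2 * k + 1) + β ^ (2 * k + 1) * carryFrac a z β k)) := by
    refine h1.prepend_of_lt hβ ((z + 2) * (k + 1) - 2) (by nlinarith) ?_ rfl rfl
    have : (z + 2) * (k + 1) - 2 + 1 ≤ a := by linarith
    have : (((z + 2) * (k + 1) - 2 : ℤ) : ℝ) + 1 ≤ a := by exact_mod_cast this
    linarith
  have h3 := carrySum_sub_carryFrac_reaches ha hz hβ hab hroot k (by nlinarith) h2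
  convert h3 using 1
  · ring
  · have e := carryFrac_succ hβ hroot k
    push_cast
    have e2 : β ^ (2 * k + 3) * (2 / β) = 2 * β ^ (2 * k + 2) := by
      rw [pow_succ β (2 * k + 2)]
      field_simp
    rw [show 2 * (k + 1) + 1 = 2 * k + 3 by ring, show 2 * k + 2 + 1 = 2 * k + 3 by ring]
    linear_combination e - e2

lemma exists_long_sum (ha : 1 < a) (hz : 0 ≤ z) (haz : 0 < a - z) (hβ : 1 < β)
    (hroot : β ^ 3 - (a : ℝ) * β ^ 2 - ((a : ℝ) - (z : ℝ)) * β - 1 = 0) (k : ℕ) (hk1 : 1 ≤ k)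
    (hk : (k : ℤ) * z + 2 * (k : ℤ) - 1 ≤ a) :
    ∃ x ∈ betaInt β, ∃ y ∈ betaInt β,
      x + y ∈ finBeta β ∧ β ^ (2 * k) * (x + y) ∉ betaInt β := by
  have h0 : β ≠ 0 := by positivity
  have hab := lt_of_root hβ haz hroot
  have hab2 := mul_add_one_lt_sq_of_root hβ haz hroot
  obtain ⟨k, rfl⟩ : ∃ l, k = l + 1 := ⟨k - 1, by omega⟩
  push_cast at hk
  have hS := carrySum_reaches ha hz hβ hab hroot k (by linarith)
  set f : ℕ → ℤ := fun i => 1 + (z + 2) * ((k + 1 : ℕ) - 1 - i)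
  have hx := sum_mul_sq_pow_reaches hβ hab2 (fun _ => a) (k + 1) (fun i _ => ⟨by omega, le_rfl⟩)
  have hy := sum_mul_sq_pow_reaches hβ hab2 f (k + 1) (fun i hi => by
    have h1 : (0 : ℤ) ≤ k - i := by omega
    have h2 : 0 ≤ (z + 2) * (k - i) := by positivity
    have h3 : (z + 2) * (k - i) ≤ (z + 2) * k := by gcongr; omega
    simp only [f]
    push_cast
    constructor <;> nlinarith)
  have hxy : ∑ i ∈ Finset.range (k + 1), (a : ℝ) * (β ^ 2) ^ i +
      ∑ i ∈ Finset.range (k + 1), (f i : ℝ) * (β ^ 2) ^ i = carrySum a z β (k + 1) := by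
    rw [← Finset.sum_add_distrib, carrySum]
    refine Finset.sum_congr rfl fun i _ => ?_
    simp only [f]
    push_cast
    ring
  refine ⟨_, hx.1.mem_betaInt hβ, _, hy.1.mem_betaInt hβ, ?_, ?_⟩ <;> rw [hxy]
  · have := div_pow_mem_finBeta (L := 2 * (k + 1) + 1) hβ hS (by omega)
    rwa [mul_div_cancel_left₀ _ (pow_ne_zero _ h0)] at this
  · have := not_mem_betaInt_div hβ hS
    rwa [pow_succ, mul_right_comm, mul_div_cancel_right₀ _ h0] at this

end Carry

section Finiteness

variable {β : ℝ} {K : Type*} [Field K]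

/-- The real number `D` lifts along `ι` to an algebraic integer that every complex embedding `φ` of
`K` sends to `D` if `φ g = β`, and into the disc of radius `C` otherwise. -/
def BoundedLift (ι : K →+* ℝ) (β : ℝ) (g : K) (C D : ℝ) : Prop :=
  ∃ w : K, ι w = D ∧ IsIntegral ℤ w ∧
    ∀ φ : K →+* ℂ, (φ g = β → φ w = D) ∧ (φ g ≠ β → ‖φ w‖ ≤ C)

variable {ι : K →+* ℝ} {g : K} {C : ℝ}

lemma BoundedLift.add {C₁ C₂ D₁ D₂ : ℝ} (h₁ : BoundedLift ι β g C₁ D₁)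
    (h₂ : BoundedLift ι β g C₂ D₂) : BoundedLift ι β g (C₁ + C₂) (D₁ + D₂) := by
  obtain ⟨w₁, e₁, i₁, b₁⟩ := h₁
  obtain ⟨w₂, e₂, i₂, b₂⟩ := h₂
  refine ⟨w₁ + w₂, by simp [e₁, e₂], i₁.add i₂, fun φ => ⟨fun h => ?_, fun h => ?_⟩⟩
  · simp [(b₁ φ).1 h, (b₂ φ).1 h]
  · rw [map_add]
    exact norm_add_le_of_le ((b₁ φ).2 h) ((b₂ φ).2 h)

lemma BoundedLift.neg {D : ℝ} (h : BoundedLift ι β g C D) : BoundedLift ι β g C (-D) := by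
  obtain ⟨w, e, i, b⟩ := h
  refine ⟨-w, by simp [e], i.neg, fun φ => ⟨fun h => ?_, fun h => ?_⟩⟩
  · simp [(b φ).1 h]
  · rw [map_neg, norm_neg]
    exact (b φ).2 h

lemma boundedLift_abs {D : ℝ} : BoundedLift ι β g C |D| ↔ BoundedLift ι β g C D := by
  rcases abs_choice D with h | h <;> rw [h]
  exact ⟨fun h => by simpa using h.neg, BoundedLift.neg⟩

lemma boundedLift_sub_iterate (hβ : 1 < β) (hg : ι g = β) (hgi : IsIntegral ℤ g) (hC0 : 0 ≤ C)
    (hC : ∀ φ : K →+* ℂ, φ g = β ∨ ‖φ g‖ * C + β ≤ C) {t : ℝ} (ht : t ∈ Set.Ico (0 : ℝ) 1)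
    (N : ℕ) : BoundedLift ι β g C (β ^ N * t - (betaT β)^[N] t) := by
  induction N with
  | zero => exact ⟨0, by simp, isIntegral_zero, fun φ => by simp [hC0]⟩
  | succ N ih =>
    obtain ⟨w, e, i, b⟩ := ih
    set u := (betaT β)^[N] t with hu
    have hu1 : u ∈ Set.Ico (0 : ℝ) 1 := betaT_iterate_mem_Ico ht N
    have h0 : 0 < β := by linarith
    have hD : β ^ (N + 1) * t - (betaT β)^[N + 1] t = β * (β ^ N * t - u) + ⌊β * u⌋ := by
      rw [Function.iterate_succ_apply', ← hu, betaT]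
      ring
    have hd : ‖((⌊β * u⌋ : ℤ) : ℂ)‖ ≤ β := by
      have h1 : (0 : ℝ) ≤ ⌊β * u⌋ := by
        exact_mod_cast Int.floor_nonneg.2 (mul_nonneg h0.le hu1.1)
      have h2 := Int.floor_le (β * u)
      rw [Complex.norm_intCast, abs_of_nonneg h1]
      nlinarith [hu1.2]
    rw [hD]
    refine ⟨g * w + (⌊β * u⌋ : ℤ), by simp [hg, e], (hgi.mul i).add ?_, fun φ =>
      ⟨fun h => ?_, fun h => ?_⟩⟩
    · simpa using (isIntegral_algebraMap (R := ℤ) (A := K) (x := ⌊β * u⌋))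
    · simp [h, (b φ).1 h]
    · have h1 := (hC φ).resolve_left h
      have h2 := (b φ).2 h
      rw [map_add, map_mul, map_intCast]
      refine (norm_add_le_of_le (norm_mul_le _ _) hd).trans (le_trans ?_ h1)
      gcongr

lemma boundedLift_of_mem_betaInt (hβ : 1 < β) (hg : ι g = β) (hgi : IsIntegral ℤ g) (hC0 : 0 ≤ C)
    (hC : ∀ φ : K →+* ℂ, φ g = β ∨ ‖φ g‖ * C + β ≤ C) {x : ℝ} (hx : x ∈ betaInt β) :
    BoundedLift ι β g C x := by
  obtain ⟨N, hN, h⟩ := hx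
  have h0 : β ≠ 0 := by positivity
  have := boundedLift_sub_iterate hβ hg hgi hC0 hC hN N
  rw [h, sub_zero, mul_div_cancel₀ _ (pow_ne_zero _ h0)] at this
  exact boundedLift_abs.1 this

lemma finite_boundedLift [NumberField K] (ι : K →+* ℝ) (β : ℝ) (g : K) (C : ℝ) :
    {D : ℝ | D ∈ Set.Ico (0 : ℝ) 1 ∧ BoundedLift ι β g C D}.Finite := by
  refine ((NumberField.Embeddings.finite_of_norm_le K ℂ (max C 1)).image ι).subset ?_
  rintro D ⟨⟨hD0, hD1⟩, w, e, i, b⟩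
  refine ⟨w, ⟨i, fun φ => ?_⟩, e⟩
  by_cases h : φ g = β
  · rw [(b φ).1 h, Complex.norm_real, Real.norm_of_nonneg hD0]
    exact hD1.le.trans (le_max_right _ _)
  · exact ((b φ).2 h).trans (le_max_left _ _)

lemma exists_common_iterate_eq_zero {S : Set ℝ} (hS : S.Finite) :
    ∃ L, ∀ u ∈ S, (∃ m, (betaT β)^[m] u = 0) → (betaT β)^[L] u = 0 := by
  induction S, hS using Set.Finite.induction_on with
  | empty => simp
  | @insert u S _ _ ih =>
    obtain ⟨L, hL⟩ := ih
    by_cases hu : ∃ m, (betaT β)^[m] u = 0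
    · obtain ⟨m, hm⟩ := hu
      refine ⟨L + m, ?_⟩
      rintro v (rfl | hv) hv'
      · rw [Function.iterate_add_apply, hm, betaT_iterate_zero]
      · rw [add_comm, Function.iterate_add_apply, hL v hv hv', betaT_iterate_zero]
    · refine ⟨L, ?_⟩
      rintro v (rfl | hv) hv'
      · exact absurd hv' hu
      · exact hL v hv hv'

/-- `L_⊕(β)` is finite if `β` is an algebraic integer whose other conjugates lie in the open unit
disc. -/
lemma exists_mul_add_mem_betaInt [NumberField K] (hβ : 1 < β) (hg : ι g = β)
    (hgi : IsIntegral ℤ g) (hconj : ∀ φ : K →+* ℂ, φ g = β ∨ ‖φ g‖ < 1) :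
    ∃ L : ℕ, ∀ x ∈ betaInt β, ∀ y ∈ betaInt β,
      x + y ∈ finBeta β → β ^ L * (x + y) ∈ betaInt β := by
  have h0 : 0 < β := by linarith
  obtain ⟨C, hC0, hC⟩ : ∃ C : ℝ, 0 ≤ C ∧ ∀ φ : K →+* ℂ, φ g = β ∨ ‖φ g‖ * C + β ≤ C := by
    obtain ⟨C, hC⟩ := Finite.exists_le fun φ : K →+* ℂ => β / (1 - ‖φ g‖)
    refine ⟨max C 0, le_max_right _ _, fun φ => (hconj φ).imp_right fun h => ?_⟩
    have h1 := (hC φ).trans (le_max_left C 0)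
    rw [div_le_iff₀ (by linarith)] at h1
    linarith
  obtain ⟨L, hL⟩ := exists_common_iterate_eq_zero (β := β)
    (finite_boundedLift ι β g (C + C + C))
  refine ⟨L, fun x hx y hy ⟨N, n, ht, hn⟩ => ?_⟩
  have hxy := (boundedLift_of_mem_betaInt hβ hg hgi hC0 hC hx).add
    (boundedLift_of_mem_betaInt hβ hg hgi hC0 hC hy)
  set t := |x + y| / β ^ N with ht'
  have hu : BoundedLift ι β g (C + C + C) ((betaT β)^[N] t) := by
    have h1 := (boundedLift_abs.2 hxy).add (boundedLift_sub_iterate hβ hg hgi hC0 hC ht N).neg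
    rw [ht', mul_div_cancel₀ _ (pow_ne_zero _ h0.ne'), ← ht'] at h1
    simpa using h1
  have hz := hL _ ⟨betaT_iterate_mem_Ico ht N, hu⟩
    ⟨n, by rw [← Function.iterate_add_apply, add_comm, Function.iterate_add_apply, hn,
      betaT_iterate_zero]⟩
  have e : |β ^ L * (x + y)| / β ^ (L + N) = t := by
    rw [abs_mul, abs_of_pos (pow_pos h0 L), pow_add, ht']
    field_simp
  refine ⟨L + N, by rwa [e], ?_⟩
  rw [e, Function.iterate_add_apply, hz]

end Finiteness

section Conjugates

variable {a z : ℤ} {β : ℝ}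

lemma norm_lt_one_of_quadratic {b c : ℝ} (hb : 0 < b) (hbc : b < 1 + c) (hc : 0 < c) (hc1 : c < 1)
    {w : ℂ} (hw : w ^ 2 + b * w + c = 0) : ‖w‖ < 1 := by
  have hre := congrArg Complex.re hw
  have him := congrArg Complex.im hw
  simp [pow_two] at hre him
  rw [← sq_lt_one_iff₀ (norm_nonneg w), Complex.sq_norm, Complex.normSq_apply]
  have h : w.im * (2 * w.re + b) = 0 := by linear_combination him
  rcases mul_eq_zero.1 h with h | h
  · rw [h] at hre ⊢
    have h1 : w.re < 0 := by
      by_contra! h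
      nlinarith
    have h2 : -1 < w.re := by
      by_contra! h
      nlinarith
    nlinarith
  · have h1 : w.re * (2 * w.re + b) = 0 := by rw [h, mul_zero]
    nlinarith

lemma eq_or_norm_lt_one_of_root (ha : 1 < a) (haz : 0 < a - z) (hz : 0 ≤ z) (hβ : 1 < β)
    (hroot : β ^ 3 - (a : ℝ) * β ^ 2 - ((a : ℝ) - (z : ℝ)) * β - 1 = 0) {w : ℂ}
    (hw : w ^ 3 - (a : ℂ) * w ^ 2 - ((a : ℂ) - (z : ℂ)) * w - 1 = 0) : w = β ∨ ‖w‖ < 1 := by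
  have h0 : 0 < β := by linarith
  have hab := lt_of_root hβ haz hroot
  have hz' : (0 : ℝ) ≤ z := by exact_mod_cast hz
  have ha' : (1 : ℝ) < a := by exact_mod_cast ha
  by_cases h : w = β
  · exact Or.inl h
  right
  have hc : 0 < 1 / β := by positivity
  have hc1 : 1 / β < 1 := (div_lt_one h0).2 hβ
  have hb : β - a < 1 + 1 / β := by
    have : β * (β - a) = a - z + 1 / β := by
      field_simp
      linear_combination hroot
    by_contra! h
    nlinarith
  have hroot' : (β : ℂ) ^ 3 - (a : ℂ) * β ^ 2 - ((a : ℂ) - (z : ℂ)) * β - 1 = 0 := by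
    exact_mod_cast congrArg (fun x : ℝ => (x : ℂ)) hroot
  refine norm_lt_one_of_quadratic (sub_pos.2 hab) hb hc hc1 ?_
  have hβ' : (β : ℂ) ≠ 0 := by exact_mod_cast h0.ne'
  refine (mul_eq_zero.1 ?_).resolve_left (mul_ne_zero hβ' (sub_ne_zero.2 h))
  push_cast
  field_simp
  linear_combination β * hw - w * hroot'

lemma exists_mul_add_mem_betaInt_of_root (ha : 1 < a) (haz : 0 < a - z) (hz : 0 ≤ z) (hβ : 1 < β)
    (hroot : β ^ 3 - (a : ℝ) * β ^ 2 - ((a : ℝ) - (z : ℝ)) * β - 1 = 0) :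
    ∃ L : ℕ, ∀ x ∈ betaInt β, ∀ y ∈ betaInt β,
      x + y ∈ finBeta β → β ^ L * (x + y) ∈ betaInt β := by
  have hβi : IsIntegral ℤ β := by
    refine ⟨X ^ 3 - C a * X ^ 2 - C (a - z) * X - C 1, ?_, ?_⟩
    · monicity!
    · simpa [-eq_intCast] using hroot
  have hβiℚ : IsIntegral ℚ β := hβi.tower_top
  let K := IntermediateField.adjoin ℚ {β}
  let g : K := IntermediateField.AdjoinSimple.gen ℚ β
  have : FiniteDimensional ℚ K := IntermediateField.adjoin.finiteDimensional hβiℚ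
  have : NumberField K := { }
  have hg : algebraMap K ℝ g = β := IntermediateField.AdjoinSimple.algebraMap_gen ℚ β
  have hgroot : g ^ 3 - (a : K) * g ^ 2 - ((a : K) - (z : K)) * g - 1 = 0 := by
    apply (algebraMap K ℝ).injective
    have hg' : (g : ℝ) = β := hg
    simpa [hg'] using hroot
  refine exists_mul_add_mem_betaInt (ι := algebraMap K ℝ) hβ hg ?_ fun φ => ?_
  · rw [← isIntegral_algebraMap_iff (algebraMap K ℝ).injective, hg]
    exact hβi
  · refine eq_or_norm_lt_one_of_root ha haz hz hβ hroot ?_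
    simpa using congrArg φ hgroot

end Conjugates

theorem stmt19 (a z : ℤ) (ha : 1 < a) (hz : 0 ≤ z) (haz : 0 < a - z) (β : ℝ)
    (hβ : 1 < β)
    (hroot : β ^ 3 - (a : ℝ) * β ^ 2 - ((a : ℝ) - (z : ℝ)) * β - 1 = 0) :
    ∀ k : ℕ, 1 ≤ k → (k : ℤ) * z + 2 * (k : ℤ) - 1 ≤ a →
      2 * k + 1 ≤ Lplus β ∧
      ∃ x ∈ betaInt β, ∃ y ∈ betaInt β,
        x + y ∈ finBeta β ∧ β ^ (2 * k) * (x + y) ∉ betaInt β := by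
  intro k hk1 hk
  have hlong := exists_long_sum ha hz haz hβ hroot k hk1 hk
  refine ⟨?_, hlong⟩
  obtain ⟨x, hx, y, hy, hxy, hnot⟩ := hlong
  have hmem := Nat.sInf_mem (exists_mul_add_mem_betaInt_of_root ha haz hz hβ hroot)
  by_contra! hlt
  obtain ⟨m, hm⟩ := Nat.exists_eq_add_of_le (Nat.lt_succ_iff.1 hlt)
  have h := mul_mem_betaInt hβ (hmem x hx y hy hxy) m
  rw [← mul_assoc, ← pow_add, add_comm] at h
  exact hnot (hm ▸ h)
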